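/- Let R̂ and F̂ be compatible R-matrices with F̂ closed, A a unital associative k-algebra, and M an arbitrary N×N matrix over A, with M_{k̄} defined as usual. For any polynomial Y^{(k)} = Y^{(k)}(R̂₁,…,R̂_{k−1}) in the operators R̂₁,…,R̂_{k−1}, set Y^{(i,k)} := Y^{(k)}(R̂_i,…,R̂_{i+k−2}) and α(Y^{(k)}) := Tr_F(1,…,k)(Y^{(k)} M_{1̄} ⋯ M_{k̄}) ∈ A. Then for every i ≥ 1, Tr_F(i,…,i+k−1)(Y^{(i,k)} M_{ī} ⋯ M_{(i+k−1)‾}) = I_{1,…,i−1} · α(Y^{(k)}), where I_{1,…,i−1} is the identity operator on the first i−1 tensor factors. -/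

import Mathlib

/-! Common definitions for quantum matrix algebras `M(R̂,F̂)` in the sense of
Isaev–Ogievetsky–Pyatov, "On quantum matrix algebras satisfying the
Cayley-Hamilton-Newton identities".

We model operators on `V^{⊗m}` (where `dim V = N`) as matrices indexed by
multi-indices `Fin m → Fin N`; entries are taken in a (possibly
noncommutative) unital associative algebra `A` over a field `K`.
Sites (tensor factors) are numbered starting from `0`, so the paper's
`X_i` is `site m (i-1) X`, and the paper's `M_{\overline{k}}` is
`Mbar m F F⁻¹ M (k-1)`. -/

namespace CHN

noncomputable section

/-- Operators on `V^{⊗m}` (`dim V = N`) with entries in a ring `A`. -/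
abbrev Op (N : ℕ) (A : Type*) [Ring A] (m : ℕ) :=
  Matrix (Fin m → Fin N) (Fin m → Fin N) A

/-- Operators on `V ⊗ V`. -/
abbrev M2 (N : ℕ) (A : Type*) [Ring A] :=
  Matrix (Fin N × Fin N) (Fin N × Fin N) A

/-- `site m i X` places the two-site operator `X` at the (0-based) tensor
factors `i, i+1` of `V^{⊗m}`, acting as the identity elsewhere.  In the
paper's 1-based notation, `X_i = site m (i-1) X`.  (Out of range it is the
identity.) -/
def site {A : Type*} [Ring A] {N : ℕ} (m i : ℕ) (X : M2 N A) : Op N A m :=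
  fun a b =>
    if h : i + 1 < m then
      X (a ⟨i, Nat.lt_of_succ_lt h⟩, a ⟨i + 1, h⟩)
          (b ⟨i, Nat.lt_of_succ_lt h⟩, b ⟨i + 1, h⟩) *
        (if ∀ j : Fin m, (j : ℕ) ≠ i → (j : ℕ) ≠ i + 1 → a j = b j then 1 else 0)
    else if a = b then 1 else 0

/-- `site1 m i X` places the one-site operator `X` at the (0-based) factor `i`. -/
def site1 {A : Type*} [Ring A] {N : ℕ} (m i : ℕ) (X : Matrix (Fin N) (Fin N) A) :
    Op N A m :=
  fun a b =>
    if h : i < m then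
      X (a ⟨i, h⟩) (b ⟨i, h⟩) *
        (if ∀ j : Fin m, (j : ℕ) ≠ i → a j = b j then 1 else 0)
    else if a = b then 1 else 0

/-- `chain m X i l = X_i X_{i+1} ⋯ X_{i+l-1}` (0-based sites, `l` factors); in
the paper's 1-based notation this is `X_{i+1 → i+l}`. -/
def chain {A : Type*} [Ring A] {N : ℕ} (m : ℕ) (X : M2 N A) (i : ℕ) :
    ℕ → Op N A m
  | 0 => 1
  | l + 1 => chain m X i l * site m (i + l) X

/-- The Yang–Baxter equation `X₁X₂X₁ = X₂X₁X₂` on `V^{⊗3}`. -/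
def YB {A : Type*} [Ring A] {N : ℕ} (X : M2 N A) : Prop :=
  site 3 0 X * site 3 1 X * site 3 0 X = site 3 1 X * site 3 0 X * site 3 1 X

/-- Compatibility of a pair of R-matrices: both Yang–Baxter equations together
with the conditions `R̂₁F̂₂F̂₁ = F̂₂F̂₁R̂₂` and `F̂₁F̂₂R̂₁ = R̂₂F̂₁F̂₂` on `V^{⊗3}`. -/
def Compatible {A : Type*} [Ring A] {N : ℕ} (R F : M2 N A) : Prop :=
  YB R ∧ YB F ∧
    site 3 0 R * site 3 1 F * site 3 0 F = site 3 1 F * site 3 0 F * site 3 1 R ∧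
    site 3 0 F * site 3 1 F * site 3 0 R = site 3 1 R * site 3 0 F * site 3 1 F

/-- `Ψ` witnesses closedness of `F̂`:  `Ψ^{af}_{cg} F̂^{gb}_{fd} = δ^a_d δ^b_c`. -/
def IsClosedPair {A : Type*} [Ring A] {N : ℕ} (F Ψ : M2 N A) : Prop :=
  ∀ a b c d : Fin N,
    (∑ f : Fin N, ∑ g : Fin N, Ψ (a, f) (c, g) * F (g, b) (f, d)) =
      if a = d ∧ b = c then 1 else 0

/-- The matrix `D`, `D^a_b := Ψ^{ac}_{bc}`. -/
def Dmat {A : Type*} [Ring A] {N : ℕ} (Ψ : M2 N A) : Matrix (Fin N) (Fin N) A :=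
  fun a b => ∑ c : Fin N, Ψ (a, c) (b, c)

/-- Quantum trace (with weight `D`) over the last tensor factor. -/
def qtr1 {K : Type*} [Field K] {A : Type*} [Ring A] [Algebra K A] {N m : ℕ}
    (D : Matrix (Fin N) (Fin N) K) (X : Op N A (m + 1)) : Op N A m :=
  fun a b => ∑ c : Fin N, ∑ e : Fin N,
    algebraMap K A (D c e) * X (Fin.snoc a e) (Fin.snoc b c)

/-- Quantum trace over the last `j` tensor factors. -/
def qtrs {K : Type*} [Field K] {A : Type*} [Ring A] [Algebra K A] {N : ℕ}
    (D : Matrix (Fin N) (Fin N) K) (m : ℕ) :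
    (j : ℕ) → Op N A (m + j) → Op N A m
  | 0, X => X
  | j + 1, X => qtrs D m j (qtr1 D X)

/-- Full quantum trace `Tr_F(1,…,m)`, with values in `A`. -/
def qtrAll {K : Type*} [Field K] {A : Type*} [Ring A] [Algebra K A] {N m : ℕ}
    (D : Matrix (Fin N) (Fin N) K) (X : Op N A m) : A :=
  ∑ a : Fin m → Fin N, ∑ b : Fin m → Fin N,
    algebraMap K A (∏ i, D (a i) (b i)) * X b a

/-- Quantum trace of a one-site operator:  `Tr_F X = Tr (D X)`. -/
def trF {K : Type*} [Field K] {A : Type*} [Ring A] [Algebra K A] {N : ℕ}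
    (D : Matrix (Fin N) (Fin N) K) (X : Matrix (Fin N) (Fin N) A) : A :=
  ∑ a : Fin N, ∑ b : Fin N, algebraMap K A (D a b) * X b a

/-- Ordinary partial trace over the last tensor factor. -/
def ptr1 {A : Type*} [Ring A] {N m : ℕ} (X : Op N A (m + 1)) : Op N A m :=
  fun a b => ∑ c : Fin N, X (Fin.snoc a c) (Fin.snoc b c)

/-- Ordinary partial trace over the last `j` tensor factors. -/
def ptrs {A : Type*} [Ring A] {N : ℕ} (m : ℕ) :
    (j : ℕ) → Op N A (m + j) → Op N A m
  | 0, X => X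
  | j + 1, X => ptrs m j (ptr1 X)

/-- `Mbar m F Finv M k` is the paper's `M_{\overline{k+1}}` (0-based index `k`):
`M_{\overline{1}} := M₁` and `M_{\overline{k+1}} := F̂_k M_{\overline{k}} F̂_k⁻¹`. -/
def Mbar {A : Type*} [Ring A] {N : ℕ} (m : ℕ) (F Finv : M2 N A)
    (M : Matrix (Fin N) (Fin N) A) : ℕ → Op N A m
  | 0 => site1 m 0 M
  | k + 1 => site m k F * Mbar m F Finv M k * site m k Finv

/-- `MbarSeg m F Finv M i l = M_{\overline{i+1}} M_{\overline{i+2}} ⋯ M_{\overline{i+l}}`,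
the ordered product of `l` consecutive copies starting at 0-based index `i`.
In particular `MbarSeg m F Finv M 0 k = M_{\overline{1}} ⋯ M_{\overline{k}}`. -/
def MbarSeg {A : Type*} [Ring A] {N : ℕ} (m : ℕ) (F Finv : M2 N A)
    (M : Matrix (Fin N) (Fin N) A) (i : ℕ) : ℕ → Op N A m
  | 0 => 1
  | l + 1 => MbarSeg m F Finv M i l * Mbar m F Finv M (i + l)

/-- The double twist `R̂^{FF} = F̂ (F̂ R̂ F̂⁻¹) F̂⁻¹`. -/
def RFF {K : Type*} [Field K] {N : ℕ} (R F : M2 N K) : M2 N K :=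
  F * (F * R * F⁻¹) * F⁻¹

/-- `M` is a matrix of generators of the algebra `M(R̂,F̂)`:
`R̂₁ M_{\overline{1}} M_{\overline{2}} = M_{\overline{1}} M_{\overline{2}} (R̂^{FF})₁`
on `V ⊗ V`. -/
def IsGenerators {K : Type*} [Field K] {A : Type*} [Ring A] [Algebra K A] {N : ℕ}
    (R F : M2 N K) (M : Matrix (Fin N) (Fin N) A) : Prop :=
  site 2 0 (R.map (algebraMap K A)) *
      MbarSeg 2 (F.map (algebraMap K A)) ((F⁻¹).map (algebraMap K A)) M 0 2 =
    MbarSeg 2 (F.map (algebraMap K A)) ((F⁻¹).map (algebraMap K A)) M 0 2 *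
      site 2 0 ((RFF R F).map (algebraMap K A))

/-- Evaluation of a noncommutative polynomial `Y` in `v` variables, substituting
for the variable `x_j` the operator `R̂` placed at the (0-based) sites
`p+j, p+j+1` of `V^{⊗m}`.  For `p = 0` this is the paper's
`Y^{(v+1)} = Y^{(v+1)}(R̂₁,…,R̂_v)`, and a general `p` gives `Y^{(p+1,v+1)}`. -/
def evalY {K : Type*} [Field K] {A : Type*} [Ring A] [Algebra K A] {N m v : ℕ}
    (R : M2 N A) (p : ℕ) (Y : FreeAlgebra K (Fin v)) : Op N A m :=
  FreeAlgebra.lift K (fun j : Fin v => site m (p + (j : ℕ)) R) Y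

/-- `Ustack m R k l = R̂_{l → l+k-1} ⋯ R̂_{2 → k+1} R̂_{1 → k}` (1-based labels):
the product of `l` descending chains of length `k`. -/
def Ustack {A : Type*} [Ring A] {N : ℕ} (m : ℕ) (R : M2 N A) (k : ℕ) :
    ℕ → Op N A m
  | 0 => 1
  | l + 1 => chain m R l k * Ustack m R k l

/-- The `q`-number `n_q = (qⁿ − q⁻ⁿ)/(q − q⁻¹)`. -/
def qInt {K : Type*} [Field K] (q : K) (n : ℕ) : K :=
  (q ^ n - q⁻¹ ^ n) / (q - q⁻¹)

/-- `R̂` is a Hecke R-matrix for the parameter `q`:  it is invertible, satisfies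
the Yang–Baxter equation and the Hecke condition `R̂² = 1 + (q − q⁻¹)R̂`. -/
def IsHecke {K : Type*} [Field K] {N : ℕ} (q : K) (R : M2 N K) : Prop :=
  IsUnit R ∧ YB R ∧ R * R = 1 + (q - q⁻¹) • R

/-- The `q`-antisymmetrizer `A^{(k)}` built from `R̂`, placed at the (0-based)
tensor factors `p, p+1, …, p+k-1` of `V^{⊗m}`. -/
def qasym {K : Type*} [Field K] {N : ℕ} (q : K) (R : M2 N K) (m p : ℕ) :
    ℕ → Op N K m
  | 0 => 1
  | 1 => 1
  | k + 2 =>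
      (qInt q (k + 2))⁻¹ •
        (qasym q R m p (k + 1) *
          (q ^ (k + 1) • (1 : Op N K m) - qInt q (k + 1) • site m (p + k) R) *
          qasym q R m p (k + 1))

/-- The `q`-symmetrizer `S^{(k)}` built from `R̂`, placed at the (0-based)
tensor factors `p, p+1, …, p+k-1` of `V^{⊗m}`. -/
def qsym {K : Type*} [Field K] {N : ℕ} (q : K) (R : M2 N K) (m p : ℕ) :
    ℕ → Op N K m
  | 0 => 1
  | 1 => 1
  | k + 2 =>
      (qInt q (k + 2))⁻¹ •
        (qsym q R m p (k + 1) *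
          (q⁻¹ ^ (k + 1) • (1 : Op N K m) + qInt q (k + 1) • site m (p + k) R) *
          qsym q R m p (k + 1))

/-- The elementary symmetric function
`σ_k(M) = Tr_F(1,…,k)(A^{(k)} M_{\overline{1}}⋯M_{\overline{k}})` (with `σ_0 = 1`). -/
def sigmaF {K : Type*} [Field K] {A : Type*} [Ring A] [Algebra K A] {N : ℕ}
    (q : K) (R F Ψ : M2 N K) (M : Matrix (Fin N) (Fin N) A) (k : ℕ) : A :=
  qtrAll (Dmat Ψ)
    ((qasym q R k 0 k).map (algebraMap K A) *
      MbarSeg k (F.map (algebraMap K A)) ((F⁻¹).map (algebraMap K A)) M 0 k)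

/-- The complete symmetric function
`τ_k(M) = Tr_F(1,…,k)(S^{(k)} M_{\overline{1}}⋯M_{\overline{k}})` (with `τ_0 = 1`). -/
def tauF {K : Type*} [Field K] {A : Type*} [Ring A] [Algebra K A] {N : ℕ}
    (q : K) (R F Ψ : M2 N K) (M : Matrix (Fin N) (Fin N) A) (k : ℕ) : A :=
  qtrAll (Dmat Ψ)
    ((qsym q R k 0 k).map (algebraMap K A) *
      MbarSeg k (F.map (algebraMap K A)) ((F⁻¹).map (algebraMap K A)) M 0 k)

/-- The power sums `s_k(M) = Tr_F(1,…,k)(R̂_{1→k−1} M_{\overline{1}}⋯M_{\overline{k}})`,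
with `s_0 = 1`. -/
def sF {K : Type*} [Field K] {A : Type*} [Ring A] [Algebra K A] {N : ℕ}
    (R F Ψ : M2 N K) (M : Matrix (Fin N) (Fin N) A) : ℕ → A
  | 0 => 1
  | j + 1 =>
      qtrAll (Dmat Ψ)
        (chain (j + 1) (R.map (algebraMap K A)) 0 j *
          MbarSeg (j + 1) (F.map (algebraMap K A)) ((F⁻¹).map (algebraMap K A)) M 0 (j + 1))

/-- The `(j+1)`-st quantum power of `M`,
`M^{\overline{j+1}} = Tr_F(2,…,j+1)(R̂_{1→j} M_{\overline{1}}⋯M_{\overline{j+1}})`,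
as a one-site operator (so `MpowF R F Ψ M 0 = M₁ = M`). -/
def MpowF {K : Type*} [Field K] {A : Type*} [Ring A] [Algebra K A] {N : ℕ}
    (R F Ψ : M2 N K) (M : Matrix (Fin N) (Fin N) A) (j : ℕ) : Op N A 1 :=
  qtrs (Dmat Ψ) 1 j
    (chain (1 + j) (R.map (algebraMap K A)) 0 j *
      MbarSeg (1 + j) (F.map (algebraMap K A)) ((F⁻¹).map (algebraMap K A)) M 0 (j + 1))

/-- The `(j+1)`-st wedge power of `M`,
`M^{∧(j+1)} = Tr_F(2,…,j+1)(A^{(j+1)} M_{\overline{1}}⋯M_{\overline{j+1}})`. -/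
def MwedgeF {K : Type*} [Field K] {A : Type*} [Ring A] [Algebra K A] {N : ℕ}
    (q : K) (R F Ψ : M2 N K) (M : Matrix (Fin N) (Fin N) A) (j : ℕ) : Op N A 1 :=
  qtrs (Dmat Ψ) 1 j
    ((qasym q R (1 + j) 0 (j + 1)).map (algebraMap K A) *
      MbarSeg (1 + j) (F.map (algebraMap K A)) ((F⁻¹).map (algebraMap K A)) M 0 (j + 1))

/-- The `(j+1)`-st symmetric power of `M`,
`M^{S(j+1)} = Tr_F(2,…,j+1)(S^{(j+1)} M_{\overline{1}}⋯M_{\overline{j+1}})`. -/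
def MsymF {K : Type*} [Field K] {A : Type*} [Ring A] [Algebra K A] {N : ℕ}
    (q : K) (R F Ψ : M2 N K) (M : Matrix (Fin N) (Fin N) A) (j : ℕ) : Op N A 1 :=
  qtrs (Dmat Ψ) 1 j
    ((qsym q R (1 + j) 0 (j + 1)).map (algebraMap K A) *
      MbarSeg (1 + j) (F.map (algebraMap K A)) ((F⁻¹).map (algebraMap K A)) M 0 (j + 1))

/-- `M^{\overline{0}} := q^{-n} n_q Tr_{(2,…,n)}(A^{(n)}) D^{-1}`, with `n = n0 + 1`
(an ordinary, non-quantum, trace over the factors `2,…,n`). -/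
def MzeroF {K : Type*} [Field K] {N : ℕ} (q : K) (R Ψ : M2 N K) (n0 : ℕ) :
    Op N K 1 :=
  (q⁻¹ ^ (n0 + 1) * qInt q (n0 + 1)) •
    (ptrs 1 n0 (qasym q R (1 + n0) 0 (n0 + 1)) * site1 1 0 ((Dmat Ψ)⁻¹))

/-- The generators of the characteristic subalgebra: all elements
`α(Y^{(k)}) = Tr_F(1,…,k)(Y^{(k)} M_{\overline{1}}⋯M_{\overline{k}})`, `k ≥ 1`. -/
def charSet {K : Type*} [Field K] {A : Type*} [Ring A] [Algebra K A] {N : ℕ}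
    (R F Ψ : M2 N K) (M : Matrix (Fin N) (Fin N) A) : Set A :=
  { x : A | ∃ (v : ℕ) (Y : FreeAlgebra K (Fin v)),
      x = qtrAll (Dmat Ψ)
        (evalY (R.map (algebraMap K A)) 0 Y *
          MbarSeg (v + 1) (F.map (algebraMap K A)) ((F⁻¹).map (algebraMap K A)) M 0 (v + 1)) }

end

open Classical in
/-- The operator on `V^{⊗β}` acting as `X` on the tensor factors selected by `e : α → β`, and as the
identity on the other factors. -/
noncomputable def emb {A ι α β : Type*} [Ring A] (e : α → β) (X : Matrix (α → ι) (α → ι) A) :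
    Matrix (β → ι) (β → ι) A :=
  fun a b => X (a ∘ e) (b ∘ e) * if ∀ j, j ∉ Set.range e → a j = b j then 1 else 0

section Emb

variable {A ι α β γ : Type*} [Ring A] {e : α → β}

theorem extend_comp_eq (he : Function.Injective e) {a c : β → ι}
    (h : ∀ j, j ∉ Set.range e → a j = c j) : Function.extend e (c ∘ e) a = c := by
  funext j
  by_cases hj : j ∈ Set.range e
  · obtain ⟨i, rfl⟩ := hj
    simp [he.extend_apply]
  · rw [Function.extend_apply' _ _ _ (by simpa using hj), h j hj]

theorem emb_smul {S : Type*} [SMul S A] [IsScalarTower S A A] (r : S)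
    (X : Matrix (α → ι) (α → ι) A) : emb e (r • X) = r • emb e X := by
  ext a b
  simp only [emb, Matrix.smul_apply, smul_mul_assoc]

theorem emb_add (X Y : Matrix (α → ι) (α → ι) A) : emb e (X + Y) = emb e X + emb e Y := by
  ext a b
  simp only [emb, Matrix.add_apply, add_mul]

theorem emb_one [DecidableEq ι] [Fintype α] [Fintype β] :
    emb e (1 : Matrix (α → ι) (α → ι) A) = 1 := by
  ext a b
  by_cases h : a = b
  · subst h
    simp [emb]
  rw [Matrix.one_apply_ne h, emb]
  by_cases h' : a ∘ e = b ∘ e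
  · rw [if_neg, mul_zero]
    refine fun hj => h (funext fun j => ?_)
    by_cases hr : j ∈ Set.range e
    · obtain ⟨i, rfl⟩ := hr
      exact congrFun h' i
    · exact hj j hr
  · rw [Matrix.one_apply_ne h', zero_mul]

variable [Fintype ι] [Fintype α] [Fintype β] [DecidableEq α] [DecidableEq β]

theorem emb_mul_apply (he : Function.Injective e) (X : Matrix (α → ι) (α → ι) A)
    (W : Matrix (β → ι) (β → ι) A) (a b : β → ι) :
    (emb e X * W) a b = ∑ d, X (a ∘ e) d * W (Function.extend e d a) b := by
  rw [Matrix.mul_apply]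
  symm
  refine Fintype.sum_of_injective (fun d => Function.extend e d a) ?_ _ _ ?_ ?_
  · intro d d' h
    rw [← Function.extend_comp he d a, ← Function.extend_comp he d' a]
    exact congrArg (· ∘ e) h
  · intro c hc
    rw [emb, if_neg, mul_zero, zero_mul]
    exact fun h => hc ⟨c ∘ e, extend_comp_eq he h⟩
  · intro d
    rw [emb, Function.extend_comp he, if_pos, mul_one]
    exact fun j hj => (Function.extend_apply' _ _ _ (by simpa using hj)).symm

theorem mul_emb_apply (he : Function.Injective e) (X : Matrix (α → ι) (α → ι) A)
    (W : Matrix (β → ι) (β → ι) A) (a b : β → ι) :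
    (W * emb e X) a b = ∑ d, W a (Function.extend e d b) * X d (b ∘ e) := by
  rw [Matrix.mul_apply]
  symm
  refine Fintype.sum_of_injective (fun d => Function.extend e d b) ?_ _ _ ?_ ?_
  · intro d d' h
    rw [← Function.extend_comp he d b, ← Function.extend_comp he d' b]
    exact congrArg (· ∘ e) h
  · intro c hc
    rw [emb, if_neg, mul_zero, mul_zero]
    exact fun h => hc ⟨c ∘ e, extend_comp_eq he fun j hj => (h j hj).symm⟩
  · intro d
    rw [emb, Function.extend_comp he, if_pos, mul_one]
    exact fun j hj => Function.extend_apply' _ _ _ (by simpa using hj)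

theorem emb_mul (he : Function.Injective e) (X Y : Matrix (α → ι) (α → ι) A) :
    emb e (X * Y) = emb e X * emb e Y := by
  ext a b
  rw [emb_mul_apply he, emb, Matrix.mul_apply, Finset.sum_mul]
  refine Finset.sum_congr rfl fun d _ => ?_
  rw [emb, Function.extend_comp he, mul_assoc]
  congr 3
  refine propext (forall₂_congr fun j hj => ?_)
  rw [Function.extend_apply' _ _ _ (by simpa using hj)]

open Classical in
theorem emb_mul_emb_apply {f : γ → β} (he : Function.Injective e) (hef : ∀ i j, e i ≠ f j)
    (X : Matrix (α → ι) (α → ι) A) (W : Matrix (γ → ι) (γ → ι) A) (a b : β → ι) :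
    (emb e X * emb f W) a b = X (a ∘ e) (b ∘ e) * W (a ∘ f) (b ∘ f) *
      if ∀ j, j ∉ Set.range e → j ∉ Set.range f → a j = b j then 1 else 0 := by
  rw [emb_mul_apply he, Finset.sum_eq_single (b ∘ e)]
  · have h₁ : Function.extend e (b ∘ e) a ∘ f = a ∘ f := by
      funext j
      exact Function.extend_apply' _ _ _ (by simpa using fun i => hef i j)
    rw [emb, h₁, ← mul_assoc]
    congr 2
    refine propext (forall_congr' fun j => ?_)
    by_cases hr : j ∈ Set.range e
    · obtain ⟨i, rfl⟩ := hr
      simp [he.extend_apply]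
    · rw [Function.extend_apply' _ _ _ (by simpa using hr)]
      tauto
  · intro d _ hd
    rw [emb, if_neg, mul_zero, mul_zero]
    refine fun h => hd (funext fun i => ?_)
    rw [← he.extend_apply d a i]
    exact h (e i) fun ⟨j, hj⟩ => hef i j hj.symm
  · simp

/-- Operators acting on disjoint sets of tensor factors commute, provided their entries do. -/
theorem emb_commute [Fintype γ] [DecidableEq γ] {f : γ → β} (he : Function.Injective e)
    (hf : Function.Injective f) (hef : ∀ i j, e i ≠ f j) {X : Matrix (α → ι) (α → ι) A} {W : Matrix (γ → ι) (γ → ι) A}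
    (h : ∀ a b c d, Commute (X a b) (W c d)) : Commute (emb e X) (emb f W) := by
  ext a b
  rw [emb_mul_emb_apply he hef, emb_mul_emb_apply hf fun i j => (hef j i).symm, (h _ _ _ _).eq]
  congr 2
  exact propext (forall_congr' fun j => ⟨fun h hf he => h he hf, fun h he hf => h hf he⟩)

end Emb

section Sites

variable {A : Type*} [Ring A] {N n m : ℕ}

theorem emb_site {e : Fin n → Fin m} {p i : ℕ} (he : ∀ t, (e t : ℕ) = p + t) (hi : i + 1 < n)
    (X : M2 N A) : emb e (site n i X) = site m (p + i) X := by
  ext a b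
  have hm : p + i + 1 < m := by
    have := (e ⟨i + 1, hi⟩).2
    rwa [he] at this
  have h0 : e ⟨i, by omega⟩ = ⟨p + i, by omega⟩ := Fin.ext (he _)
  have h1 : e ⟨i + 1, hi⟩ = ⟨p + i + 1, hm⟩ := Fin.ext (he _)
  rw [emb, site, dif_pos hi, site, dif_pos hm, mul_assoc]
  simp only [Function.comp_apply, h0, h1, ite_zero_mul_ite_zero, mul_one]
  congr 2
  refine propext ⟨fun h j hj hj' => ?_, fun h => ⟨fun j hj hj' => ?_, fun j hj => ?_⟩⟩
  · by_cases hr : j ∈ Set.range e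
    · obtain ⟨t, rfl⟩ := hr
      rw [he] at hj hj'
      exact h.1 t (by omega) (by omega)
    · exact h.2 j hr
  · exact h (e j) (by rw [he]; omega) (by rw [he]; omega)
  · refine h j (fun hj' => hj ⟨⟨i, by omega⟩, ?_⟩) (fun hj' => hj ⟨⟨i + 1, hi⟩, ?_⟩)
    · rw [h0]; exact Fin.ext hj'.symm
    · rw [h1]; exact Fin.ext hj'.symm

theorem emb_site1 {e : Fin n → Fin m} {p i : ℕ} (he : ∀ t, (e t : ℕ) = p + t) (hi : i < n)
    (X : Matrix (Fin N) (Fin N) A) : emb e (site1 n i X) = site1 m (p + i) X := by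
  ext a b
  have hm : p + i < m := by have := (e ⟨i, hi⟩).2; rw [he] at this; exact this
  have h0 : e ⟨i, hi⟩ = ⟨p + i, hm⟩ := Fin.ext (he _)
  rw [emb, site1, dif_pos hi, site1, dif_pos hm, mul_assoc]
  simp only [Function.comp_apply, h0, ite_zero_mul_ite_zero, mul_one]
  congr 2
  refine propext ⟨fun h j hj => ?_, fun h => ⟨fun j hj => ?_, fun j hj => ?_⟩⟩
  · by_cases hr : j ∈ Set.range e
    · obtain ⟨t, rfl⟩ := hr
      rw [he] at hj
      exact h.1 t (by omega)
    · exact h.2 j hr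
  · exact h (e j) (by rw [he]; omega)
  · exact h j fun hj' => hj ⟨⟨i, hi⟩, h0.trans (Fin.ext hj'.symm)⟩

/-- The inclusion of `n` consecutive tensor factors, starting at the factor `p`. -/
def shift (n p : ℕ) (h : p + n ≤ m) (t : Fin n) : Fin m :=
  ⟨p + t, by omega⟩

theorem shift_injective {p : ℕ} (h : p + n ≤ m) : Function.Injective (shift n p h) := by
  intro s t hst
  simp only [shift, Fin.mk.injEq] at hst
  exact Fin.ext (by omega)

theorem emb_shift_site {p i : ℕ} (h : p + n ≤ m) (hi : i + 1 < n) (X : M2 N A) :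
    emb (shift n p h) (site n i X) = site m (p + i) X :=
  emb_site (fun _ => rfl) hi X

theorem emb_shift_site1 {p i : ℕ} (h : p + n ≤ m) (hi : i < n) (X : Matrix (Fin N) (Fin N) A) :
    emb (shift n p h) (site1 n i X) = site1 m (p + i) X :=
  emb_site1 (fun _ => rfl) hi X

theorem site_eq_one {i : ℕ} (hi : ¬ i + 1 < m) (X : M2 N A) : site m i X = 1 := by
  ext a b
  rw [site, dif_neg hi, Matrix.one_apply]

theorem site_two_zero (X : M2 N A) :
    site 2 0 X = X.submatrix (finTwoArrowEquiv (Fin N)) (finTwoArrowEquiv (Fin N)) := by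
  ext a b
  rw [site, dif_pos (by norm_num), if_pos, mul_one]
  · rfl
  · intro j h0 h1
    omega

theorem site_eq_emb {i : ℕ} (h : i + 2 ≤ m) (X : M2 N A) :
    site m i X = emb (shift 2 i h) (site 2 0 X) :=
  (emb_shift_site (i := 0) h (by norm_num) X).symm

theorem site1_eq_emb {i : ℕ} (h : i + 1 ≤ m) (X : Matrix (Fin N) (Fin N) A) :
    site1 m i X = emb (shift 1 i h) (site1 1 0 X) :=
  (emb_shift_site1 (i := 0) h (by norm_num) X).symm

theorem site_mul (i : ℕ) (X Y : M2 N A) : site m i (X * Y) = site m i X * site m i Y := by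
  by_cases hi : i + 1 < m
  · have h : i + 2 ≤ m := hi
    rw [site_eq_emb h, site_eq_emb h, site_eq_emb h, ← emb_mul (shift_injective h), site_two_zero,
      site_two_zero, site_two_zero, Matrix.submatrix_mul_equiv]
  · simp only [site_eq_one hi, mul_one]

theorem site_one (i : ℕ) : site m i (1 : M2 N A) = 1 := by
  by_cases hi : i + 1 < m
  · have h : i + 2 ≤ m := hi
    rw [← emb_one (e := shift 2 i h), ← Matrix.submatrix_one_equiv (finTwoArrowEquiv (Fin N)),
      ← site_two_zero, emb_shift_site h (by norm_num), add_zero]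
  · exact site_eq_one hi 1

theorem site_mul_site_eq_one {X Y : M2 N A} (h : X * Y = 1) (i : ℕ) :
    site m i X * site m i Y = 1 := by
  rw [← site_mul, h, site_one]

theorem site_map {B : Type*} [Ring B] (f : A →+* B) (i : ℕ) (X : M2 N A) :
    site m i (X.map f) = (site m i X).map f := by
  ext a b
  simp only [site, Matrix.map_apply]
  split_ifs <;> simp

/-- A cubic identity between two-site operators on `V^{⊗3}` holds at any three consecutive tensor
factors. -/
theorem site_triple {X Y Z X' Y' Z' : M2 N A} {x y z x' y' z' : ℕ}
    (hx : x < 2) (hy : y < 2) (hz : z < 2) (hx' : x' < 2) (hy' : y' < 2) (hz' : z' < 2)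
    (h : site 3 x X * site 3 y Y * site 3 z Z = site 3 x' X' * site 3 y' Y' * site 3 z' Z')
    {i : ℕ} (hi : i + 2 < m) :
    site m (i + x) X * site m (i + y) Y * site m (i + z) Z =
      site m (i + x') X' * site m (i + y') Y' * site m (i + z') Z' := by
  have h3 : i + 3 ≤ m := hi
  simpa (disch := omega) only [emb_mul (shift_injective h3), emb_shift_site] using
    congrArg (emb (shift 3 i h3)) h

theorem site_commute {X Y : M2 N A} (h : ∀ a b c d, Commute (X a b) (Y c d)) {i j : ℕ}
    (hij : i + 1 < j) : Commute (site m i X) (site m j Y) := by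
  by_cases hj : j + 1 < m
  · have h1 : i + 2 ≤ m := by omega
    have h2 : j + 2 ≤ m := by omega
    rw [site_eq_emb h1, site_eq_emb h2]
    refine emb_commute (shift_injective h1) (shift_injective h2) ?_ ?_
    · intro s t hst
      simp only [shift, Fin.mk.injEq] at hst
      omega
    · intro a b c d
      simp only [site_two_zero, Matrix.submatrix_apply]
      exact h _ _ _ _
  · rw [site_eq_one hj]
    exact Commute.one_right _

theorem site_commute_site1 {X : M2 N A} {Y : Matrix (Fin N) (Fin N) A}
    (h : ∀ a b c d, Commute (X a b) (Y c d)) {i : ℕ}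
    (hi : 0 < i) : Commute (site m i X) (site1 m 0 Y) := by
  by_cases hm : i + 1 < m
  · have h1 : i + 2 ≤ m := by omega
    have h2 : 0 + 1 ≤ m := by omega
    rw [site_eq_emb h1, site1_eq_emb h2]
    refine emb_commute (shift_injective h1) (shift_injective h2) ?_ ?_
    · intro s t hst
      simp only [shift, Fin.mk.injEq] at hst
      omega
    · intro a b c d
      simp only [site_two_zero, Matrix.submatrix_apply, site1]
      rw [dif_pos (by norm_num), if_pos, mul_one]
      · exact h _ _ _ _
      · intro j hj
        omega
  · rw [site_eq_one hm]
    exact Commute.one_left _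

end Sites

section Chains

variable {A : Type*} [Ring A] {N m : ℕ} {F G R : M2 N A} {M : Matrix (Fin N) (Fin N) A}

theorem site_commute_Mbar (hF : ∀ a b x, Commute (F a b) x) (hG : ∀ a b x, Commute (G a b) x)
    {H : M2 N A} (hH : ∀ a b x, Commute (H a b) x) {i j : ℕ} (hij : i < j) :
    Commute (site m j H) (Mbar m F G M i) := by
  induction i with
  | zero => exact site_commute_site1 (fun a b c d => hH a b _) hij
  | succ i ih =>
    have h1 : Commute (site m j H) (site m i F) :=
      (site_commute (fun a b c d => hF a b _) hij).symm
    have h2 : Commute (site m j H) (site m i G) :=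
      (site_commute (fun a b c d => hG a b _) hij).symm
    exact (h1.mul_right (ih (by omega))).mul_right h2

theorem site_braid (hYB : YB F) {i : ℕ} (hi : i + 2 < m) :
    site m i F * site m (i + 1) F * site m i F =
      site m (i + 1) F * site m i F * site m (i + 1) F :=
  site_triple (by norm_num) (by norm_num) (by norm_num) (by norm_num) (by norm_num) (by norm_num)
    hYB hi

theorem site_commute_Mbar_of_lt (hF : ∀ a b x, Commute (F a b) x)
    (hG : ∀ a b x, Commute (G a b) x) (hFG : F * G = 1) (hGF : G * F = 1) (hYB : YB F)
    {i j : ℕ} (hij : i + 1 < j) (hj : j < m) :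
    Commute (site m i F) (Mbar m F G M j) := by
  induction j, hij using Nat.le_induction with
  | base =>
    have h1 : site m (i + 1) F * Mbar m F G M i = Mbar m F G M i * site m (i + 1) F :=
      site_commute_Mbar hF hG hF (Nat.lt_succ_self i)
    have h2 := site_braid hYB hj
    have h3 (k : ℕ) : site m k F * site m k G = 1 := site_mul_site_eq_one hFG k
    have h4 (k : ℕ) : site m k G * site m k F = 1 := site_mul_site_eq_one hGF k
    have h5 : site m (i + 1) F * (site m i G * site m (i + 1) G) =
        site m i G * site m (i + 1) G * site m i F := by
      calc _ = site m i G * (site m (i + 1) G * (site m (i + 1) F * site m i F * site m (i + 1) F) *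
              (site m i G * site m (i + 1) G)) := by
            simp only [mul_assoc, ← mul_assoc (site m (i + 1) G), h4, one_mul,
              ← mul_assoc (site m i G) (site m i F)]
        _ = _ := by
            rw [← h2]
            simp only [mul_assoc, ← mul_assoc (site m i F) (site m i G), h3, one_mul,
              mul_one]
    change site m i F * (site m (i + 1) F * (site m i F * Mbar m F G M i * site m i G) *
      site m (i + 1) G) = site m (i + 1) F * (site m i F * Mbar m F G M i * site m i G) *
      site m (i + 1) G * site m i F
    calc _ = site m i F * site m (i + 1) F * site m i F * Mbar m F G M i *
            (site m i G * site m (i + 1) G) := by simp only [mul_assoc]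
      _ = site m (i + 1) F * site m i F * (Mbar m F G M i * site m (i + 1) F) *
            (site m i G * site m (i + 1) G) := by rw [h2, ← h1]; simp only [mul_assoc]
      _ = site m (i + 1) F * site m i F * Mbar m F G M i *
            (site m (i + 1) F * (site m i G * site m (i + 1) G)) := by simp only [mul_assoc]
      _ = _ := by rw [h5]; simp only [mul_assoc]
  | succ j hij ih =>
    have h1 : Commute (site m i F) (site m j F) := site_commute (fun a b c d => hF a b _) hij
    have h2 : Commute (site m i F) (site m j G) := site_commute (fun a b c d => hF a b _) hij
    exact (h1.mul_right (ih (by omega))).mul_right h2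

theorem chain_commute {X : Op N A m} {i l : ℕ} (h : ∀ j < l, Commute (site m (i + j) F) X) :
    Commute (chain m F i l) X := by
  induction l with
  | zero => exact Commute.one_left X
  | succ l ih => exact (ih fun j hj => h j (by omega)).mul_left (h l (by omega))

theorem chain_semiconj_Mbar (hF : ∀ a b x, Commute (F a b) x) (hG : ∀ a b x, Commute (G a b) x)
    (hFG : F * G = 1) (hGF : G * F = 1) (hYB : YB F) {i l p : ℕ} (hip : i ≤ p) (hpl : p < i + l)
    (hm : i + l < m) :
    SemiconjBy (chain m F i l) (Mbar m F G M p) (Mbar m F G M (p + 1)) := by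
  induction l with
  | zero => omega
  | succ l ih =>
    obtain h | rfl : p < i + l ∨ p = i + l := by omega
    · exact (ih h (by omega)).mul_left (site_commute_Mbar hF hG hF h)
    · refine SemiconjBy.mul_left (y := Mbar m F G M (i + l + 1)) ?_ ?_
      · exact chain_commute fun j hj =>
          site_commute_Mbar_of_lt hF hG hFG hGF hYB (by omega) (by omega)
      · change site m (i + l) F * Mbar m F G M (i + l) =
          site m (i + l) F * Mbar m F G M (i + l) * site m (i + l) G * site m (i + l) F
        rw [mul_assoc _ (site m (i + l) G), site_mul_site_eq_one hGF, mul_one]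

theorem chain_semiconj_MbarSeg (hF : ∀ a b x, Commute (F a b) x)
    (hG : ∀ a b x, Commute (G a b) x) (hFG : F * G = 1) (hGF : G * F = 1) (hYB : YB F)
    {i l p : ℕ} (hpl : p ≤ l) (hm : i + l < m) :
    SemiconjBy (chain m F i l) (MbarSeg m F G M i p) (MbarSeg m F G M (i + 1) p) := by
  induction p with
  | zero => exact SemiconjBy.one_right _
  | succ p ih =>
    have := chain_semiconj_Mbar (M := M) (p := i + p) hF hG hFG hGF hYB (by omega)
      (by omega) hm
    rw [add_right_comm] at this
    exact (ih (by omega)).mul_right this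

theorem chain_semiconj_site (hF : ∀ a b x, Commute (F a b) x)
    (h : site 3 0 F * site 3 1 F * site 3 0 R = site 3 1 R * site 3 0 F * site 3 1 F)
    {i l p : ℕ} (hip : i ≤ p) (hpl : p + 1 < i + l) (hm : i + l < m) :
    SemiconjBy (chain m F i l) (site m p R) (site m (p + 1) R) := by
  induction l with
  | zero => omega
  | succ l ih =>
    obtain h' | h' : p + 1 < i + l ∨ p + 1 = i + l := by omega
    · exact (ih h' (by omega)).mul_left (site_commute (fun a b c d => (hF c d _).symm) h').symm
    · obtain ⟨l, rfl⟩ : ∃ l', l = l' + 1 := ⟨l - 1, by omega⟩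
      obtain rfl : p = i + l := by omega
      change SemiconjBy (chain m F i l * site m (i + l) F * site m (i + l + 1) F) _ _
      rw [mul_assoc]
      refine SemiconjBy.mul_left (y := site m (i + l + 1) R) ?_ ?_
      · exact chain_commute fun j hj => site_commute (fun a b c d => hF a b _) (by omega)
      · have := site_triple (m := m) (i := i + l) (by norm_num) (by norm_num) (by norm_num)
          (by norm_num) (by norm_num) (by norm_num) h (by omega)
        rw [SemiconjBy, ← mul_assoc]
        exact this

theorem chain_semiconj_evalY {K : Type*} [Field K] [Algebra K A]
    (hF : ∀ a b x, Commute (F a b) x)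
    (h : site 3 0 F * site 3 1 F * site 3 0 R = site 3 1 R * site 3 0 F * site 3 1 F)
    {i v : ℕ} (hm : i + (v + 1) < m) (Y : FreeAlgebra K (Fin v)) :
    SemiconjBy (chain m F i (v + 1)) (evalY R i Y) (evalY R (i + 1) Y) := by
  unfold evalY
  induction Y using FreeAlgebra.induction with
  | grade0 r =>
    simp only [AlgHom.commutes]
    exact (Algebra.commutes r _).symm
  | grade1 j =>
    simp only [FreeAlgebra.lift_ι_apply]
    rw [add_right_comm]
    exact chain_semiconj_site hF h (by omega) (by omega) hm
  | mul a b ha hb =>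
    simp only [map_mul]
    exact ha.mul_right hb
  | add a b ha hb =>
    simp only [map_add]
    exact ha.add_right hb

/-- The product `X_{i+l-1} ⋯ X_{i+1} X_i` of a descending chain. -/
noncomputable def revChain (m : ℕ) (X : M2 N A) (i : ℕ) : ℕ → Op N A m
  | 0 => 1
  | l + 1 => site m (i + l) X * revChain m X i l

theorem chain_mul_revChain (hFG : F * G = 1) (i l : ℕ) :
    chain m F i l * revChain m G i l = 1 := by
  induction l with
  | zero => exact mul_one 1
  | succ l ih =>
    rw [chain, revChain, mul_assoc, ← mul_assoc (site m _ F), site_mul_site_eq_one hFG, one_mul, ih]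

end Chains

section Padding

variable {A : Type*} [Ring A] {N n m : ℕ} {F G R : M2 N A} {M : Matrix (Fin N) (Fin N) A}

theorem emb_castLE_site (h : n ≤ m) {i : ℕ} (hi : i + 1 < n) (X : M2 N A) :
    emb (Fin.castLE h) (site n i X) = site m i X := by
  simpa only [zero_add] using emb_site (p := 0) (fun t => by simp) hi X

theorem emb_castLE_mul (h : n ≤ m) (X Y : Op N A n) :
    emb (Fin.castLE h) (X * Y) = emb (Fin.castLE h) X * emb (Fin.castLE h) Y :=
  emb_mul (Fin.castLE_injective h) X Y

theorem emb_castLE_Mbar (h : n ≤ m) {p : ℕ} (hp : p < n) :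
    emb (Fin.castLE h) (Mbar n F G M p) = Mbar m F G M p := by
  induction p with
  | zero => exact emb_site1 (p := 0) (fun t => by simp) hp M
  | succ p ih =>
    rw [Mbar, emb_castLE_mul, emb_castLE_mul, emb_castLE_site h hp, emb_castLE_site h hp,
      ih (by omega), Mbar]

theorem emb_castLE_MbarSeg (h : n ≤ m) {i l : ℕ} (hl : i + l ≤ n) :
    emb (Fin.castLE h) (MbarSeg n F G M i l) = MbarSeg m F G M i l := by
  induction l with
  | zero => exact emb_one
  | succ l ih => rw [MbarSeg, emb_castLE_mul, ih (by omega), emb_castLE_Mbar h (by omega), MbarSeg]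

theorem emb_castLE_chain (h : n ≤ m) {i l : ℕ} (hl : i + l < n) :
    emb (Fin.castLE h) (chain n F i l) = chain m F i l := by
  induction l with
  | zero => exact emb_one
  | succ l ih => rw [chain, emb_castLE_mul, ih (by omega), emb_castLE_site h (by omega), chain]

theorem emb_castLE_revChain (h : n ≤ m) {i l : ℕ} (hl : i + l < n) :
    emb (Fin.castLE h) (revChain n F i l) = revChain m F i l := by
  induction l with
  | zero => exact emb_one
  | succ l ih =>
    rw [revChain, emb_castLE_mul, ih (by omega), emb_castLE_site h (by omega), revChain]

theorem emb_castLE_evalY {K : Type*} [Field K] [Algebra K A] (h : n ≤ m) {i v : ℕ}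
    (hn : i + v < n) (Y : FreeAlgebra K (Fin v)) :
    emb (Fin.castLE h) (evalY R i Y : Op N A n) = evalY R i Y := by
  unfold evalY
  induction Y using FreeAlgebra.induction with
  | grade0 r => rw [AlgHom.commutes, AlgHom.commutes, Algebra.algebraMap_eq_smul_one,
      Algebra.algebraMap_eq_smul_one, emb_smul, emb_one]
  | grade1 j =>
    simp only [FreeAlgebra.lift_ι_apply]
    exact emb_castLE_site h (by omega) R
  | mul a b ha hb => simp only [map_mul, emb_castLE_mul, ha, hb]
  | add a b ha hb => simp only [map_add, emb_add, ha, hb]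

end Padding

section Snoc

variable {A : Type*} [Ring A] {N n : ℕ}

theorem extend_castSucc_snoc (d a : Fin n → Fin N) (x : Fin N) :
    Function.extend Fin.castSucc d (Fin.snoc a x : Fin (n + 1) → Fin N) = Fin.snoc d x := by
  have h := extend_comp_eq (Fin.castSucc_injective n) (a := (Fin.snoc a x : Fin (n + 1) → Fin N))
    (c := Fin.snoc d x) fun j hj => by
      induction j using Fin.lastCases with
      | last => simp
      | cast j => exact absurd ⟨j, rfl⟩ hj
  rwa [show (Fin.snoc d x : Fin (n + 1) → Fin N) ∘ Fin.castSucc = d from by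
    funext t; simp] at h

theorem emb_castSucc_snoc (X : Op N A n) (a b : Fin n → Fin N) (x y : Fin N) :
    emb Fin.castSucc X (Fin.snoc a x : Fin (n + 1) → Fin N) (Fin.snoc b y) =
      if x = y then X a b else 0 := by
  have h (a : Fin n → Fin N) (x : Fin N) :
      (Fin.snoc a x : Fin (n + 1) → Fin N) ∘ Fin.castSucc = a := by funext t; simp
  rw [emb, h, h, mul_ite, mul_one, mul_zero]
  by_cases hxy : x = y
  · rw [if_pos hxy, if_pos]
    intro j hj
    induction j using Fin.lastCases with
    | last => simpa using hxy
    | cast j => exact absurd ⟨j, rfl⟩ hj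
  · rw [if_neg hxy, if_neg]
    exact fun h => hxy (by simpa using h (Fin.last n) (by simp))

theorem snoc_snoc_comp_shift (a : Fin n → Fin N) (x y : Fin N) :
    (Fin.snoc (Fin.snoc a x : Fin (n + 1) → Fin N) y : Fin (n + 2) → Fin N) ∘
      shift 2 n le_rfl = ![x, y] := by
  funext t
  fin_cases t
  · simp [shift, Fin.snoc]
  · simp [shift, Fin.snoc]

theorem extend_shift_snoc (d : Fin 2 → Fin N) (a : Fin n → Fin N) (x y : Fin N) :
    Function.extend (shift 2 n le_rfl) d
      (Fin.snoc (Fin.snoc a x : Fin (n + 1) → Fin N) y : Fin (n + 2) → Fin N) =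
      (Fin.snoc (Fin.snoc a (d 0) : Fin (n + 1) → Fin N) (d 1) : Fin (n + 2) → Fin N) := by
  have h := extend_comp_eq (shift_injective (n := 2) (p := n) le_rfl)
    (a := (Fin.snoc (Fin.snoc a x : Fin (n + 1) → Fin N) y : Fin (n + 2) → Fin N))
    (c := (Fin.snoc (Fin.snoc a (d 0) : Fin (n + 1) → Fin N) (d 1) : Fin (n + 2) → Fin N))
    fun j hj => by
      have : (j : ℕ) < n := by
        by_contra hn
        exact hj ⟨⟨j - n, by omega⟩, Fin.ext (by simp [shift]; omega)⟩
      simp [Fin.snoc, this, this.trans (Nat.lt_succ_self n)]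
  rwa [snoc_snoc_comp_shift, show ![d 0, d 1] = d from by funext t; fin_cases t <;> rfl] at h

theorem site_mul_snoc (X : M2 N A) (W : Op N A (n + 2)) (a : Fin n → Fin N) (x y : Fin N)
    (b : Fin (n + 2) → Fin N) :
    (site (n + 2) n X * W) (Fin.snoc (Fin.snoc a x : Fin (n + 1) → Fin N) y) b =
      ∑ x', ∑ y', X (x, y) (x', y') *
        W (Fin.snoc (Fin.snoc a x' : Fin (n + 1) → Fin N) y') b := by
  rw [site_eq_emb le_rfl, emb_mul_apply (shift_injective _), ← Fintype.sum_prod_type']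
  refine Fintype.sum_equiv (finTwoArrowEquiv (Fin N)) _ _ fun d => ?_
  rw [snoc_snoc_comp_shift, extend_shift_snoc, site_two_zero]
  rfl

theorem mul_site_snoc (X : M2 N A) (W : Op N A (n + 2)) (a : Fin n → Fin N) (x y : Fin N)
    (b : Fin (n + 2) → Fin N) :
    (W * site (n + 2) n X) b (Fin.snoc (Fin.snoc a x : Fin (n + 1) → Fin N) y) =
      ∑ x', ∑ y', W b (Fin.snoc (Fin.snoc a x' : Fin (n + 1) → Fin N) y') *
        X (x', y') (x, y) := by
  rw [site_eq_emb le_rfl, mul_emb_apply (shift_injective _), ← Fintype.sum_prod_type']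
  refine Fintype.sum_equiv (finTwoArrowEquiv (Fin N)) _ _ fun d => ?_
  rw [snoc_snoc_comp_shift, extend_shift_snoc, site_two_zero]
  rfl

theorem site_snoc (X : M2 N A) (a b : Fin n → Fin N) (x y x' y' : Fin N) :
    site (n + 2) n X (Fin.snoc (Fin.snoc a x : Fin (n + 1) → Fin N) y)
      (Fin.snoc (Fin.snoc b x' : Fin (n + 1) → Fin N) y') =
      if a = b then X (x, y) (x', y') else 0 := by
  have := site_mul_snoc X 1 a x y (Fin.snoc (Fin.snoc b x' : Fin (n + 1) → Fin N) y')
  rw [mul_one] at this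
  simp only [this, Matrix.one_apply, Fin.snoc_inj, mul_ite, mul_one, mul_zero]
  simp only [ite_and]
  simp

end Snoc

section Trace

variable {K : Type*} [Field K] {A : Type*} [Ring A] [Algebra K A] {N n : ℕ}
  {D : Matrix (Fin N) (Fin N) K}

theorem qtr1_emb_mul (X : Op N A n) (W : Op N A (n + 1)) :
    qtr1 D (emb Fin.castSucc X * W) = X * qtr1 D W := by
  ext a b
  have h (x : Fin N) : (Fin.snoc a x : Fin (n + 1) → Fin N) ∘ Fin.castSucc = a := by
    funext t; simp
  rw [Matrix.mul_apply]
  simp only [qtr1, emb_mul_apply (Fin.castSucc_injective n), extend_castSucc_snoc,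
    Finset.mul_sum, h]
  conv_rhs => rw [Finset.sum_comm]; enter [2, c]; rw [Finset.sum_comm]
  refine Finset.sum_congr rfl fun c _ => Finset.sum_congr rfl fun e _ =>
    Finset.sum_congr rfl fun d _ => ?_
  rw [← mul_assoc, ← mul_assoc, Algebra.commutes]

theorem qtr1_mul_emb (X : Op N A n) (W : Op N A (n + 1)) :
    qtr1 D (W * emb Fin.castSucc X) = qtr1 D W * X := by
  ext a b
  have h (x : Fin N) : (Fin.snoc b x : Fin (n + 1) → Fin N) ∘ Fin.castSucc = b := by
    funext t; simp
  rw [Matrix.mul_apply]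
  simp only [qtr1, mul_emb_apply (Fin.castSucc_injective n), extend_castSucc_snoc,
    Finset.mul_sum, Finset.sum_mul, h]
  conv_rhs => rw [Finset.sum_comm]; enter [2, c]; rw [Finset.sum_comm]
  refine Finset.sum_congr rfl fun c _ => Finset.sum_congr rfl fun e _ =>
    Finset.sum_congr rfl fun d _ => (mul_assoc _ _ _).symm

/-- The coefficients of `Tr_F(2)(F₁X₁G₁)` as a linear function of the matrix `X`. -/
def conjWeight (D : Matrix (Fin N) (Fin N) K) (F G : M2 N K) (u w x x' : Fin N) : K :=
  ∑ c, ∑ e, ∑ y, D c e * F (u, e) (x, y) * G (x', y) (w, c)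

theorem qtr1_conj_snoc (F G : M2 N K) (Z : Op N A (n + 1)) (a b : Fin n → Fin N)
    (u w : Fin N) :
    qtr1 D (site (n + 2) n (F.map (algebraMap K A)) * emb Fin.castSucc Z *
        site (n + 2) n (G.map (algebraMap K A))) (Fin.snoc a u) (Fin.snoc b w) =
      ∑ x', ∑ x, algebraMap K A (conjWeight D F G u w x x') *
        Z (Fin.snoc a x) (Fin.snoc b x') := by
  simp only [qtr1, mul_site_snoc, site_mul_snoc, emb_castSucc_snoc, mul_ite, mul_zero,
    Finset.sum_ite_eq', Finset.mem_univ, if_true, conjWeight, map_sum, Finset.sum_mul,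
    Finset.mul_sum]
  have key : ∀ f : Fin N → Fin N → Fin N → Fin N → Fin N → A,
      ∑ c, ∑ e, ∑ x', ∑ y, ∑ x, f c e x' y x = ∑ x', ∑ x, ∑ c, ∑ e, ∑ y, f c e x' y x := by
    intro f
    conv_rhs =>
      enter [2, x']
      rw [Finset.sum_comm]
      enter [2, c]
      rw [Finset.sum_comm]
      enter [2, e]
      rw [Finset.sum_comm]
    conv_rhs => rw [Finset.sum_comm]; enter [2, c]; rw [Finset.sum_comm]
  rw [key]
  refine Finset.sum_congr rfl fun x' _ => Finset.sum_congr rfl fun x _ =>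
    Finset.sum_congr rfl fun c _ => Finset.sum_congr rfl fun e _ =>
    Finset.sum_congr rfl fun y _ => ?_
  simp only [Matrix.map_apply, map_mul]
  rw [mul_assoc (algebraMap K A (F _ _)), ← Algebra.commutes, ← mul_assoc, ← mul_assoc]

theorem qtr1_conj {F G : M2 N K}
    (h : ∀ u w x x', conjWeight D F G u w x x' = if u = w then D x' x else 0)
    (Z : Op N A (n + 1)) :
    qtr1 D (site (n + 2) n (F.map (algebraMap K A)) * emb Fin.castSucc Z *
        site (n + 2) n (G.map (algebraMap K A))) = emb Fin.castSucc (qtr1 D Z) := by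
  ext a b
  rw [← Fin.snoc_init_self a, ← Fin.snoc_init_self b, qtr1_conj_snoc, emb_castSucc_snoc]
  simp only [h]
  split_ifs
  · rfl
  · simp

theorem qtr1_site_eq_one {F : M2 N K}
    (h : ∀ u w, ∑ c, ∑ e, D c e * F (u, e) (w, c) = if u = w then 1 else 0) :
    qtr1 D (site (n + 2) n F) = 1 := by
  ext a b
  rw [← Fin.snoc_init_self a, ← Fin.snoc_init_self b]
  simp only [qtr1, site_snoc, Matrix.one_apply, Fin.snoc_inj, Algebra.algebraMap_self, RingHom.id_apply]
  split_ifs <;> simp_all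

variable {F G Ψ : M2 N K}

/-- For invertible `F̂`, the defining relation of `Ψ` also holds with the factors exchanged. -/
theorem IsClosedPair.swap (hΨ : IsClosedPair F Ψ) (f g p q : Fin N) :
    ∑ a, ∑ c, F (g, c) (f, a) * Ψ (a, p) (c, q) = if f = p ∧ g = q then 1 else 0 := by
  let P : Matrix (Fin N × Fin N) (Fin N × Fin N) K := fun i j => Ψ (i.1, j.1) (i.2, j.2)
  let Q : Matrix (Fin N × Fin N) (Fin N × Fin N) K := fun i j => F (i.2, j.2) (i.1, j.1)
  have hPQ : P * Q = 1 := by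
    ext i j
    rw [Matrix.mul_apply, Fintype.sum_prod_type, Matrix.one_apply]
    refine (hΨ i.1 j.2 i.2 j.1).trans (if_congr ?_ rfl rfl)
    rw [Prod.ext_iff]
    tauto
  have hQP : (Q * P) (f, g) (p, q) = (1 : Matrix _ _ K) (f, g) (p, q) := by
    rw [mul_eq_one_comm.mp hPQ]
  rw [Matrix.mul_apply, Fintype.sum_prod_type, Matrix.one_apply] at hQP
  exact hQP.trans (if_congr Prod.ext_iff rfl rfl)

theorem IsClosedPair.partial_trace (hΨ : IsClosedPair F Ψ) (u w : Fin N) :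
    ∑ c, ∑ e, Dmat Ψ c e * F (u, e) (w, c) = if u = w then 1 else 0 := by
  simp only [Dmat, Finset.sum_mul]
  have h : ∀ f : Fin N → Fin N → Fin N → K,
      ∑ c, ∑ e, ∑ p, f c e p = ∑ p, ∑ c, ∑ e, f c e p := by
    intro f
    conv_rhs => rw [Finset.sum_comm]; enter [2, c]; rw [Finset.sum_comm]
  rw [h]
  simp only [mul_comm (Ψ _ _), hΨ.swap]
  by_cases huw : u = w
  · subst huw
    simp
  · rw [if_neg huw]
    exact Finset.sum_eq_zero fun p _ => if_neg fun hp => huw (hp.2.trans hp.1.symm)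

theorem IsClosedPair.eq_zero_of_sum (hΨ : IsClosedPair F Ψ) {X : Matrix (Fin N) (Fin N) K}
    (h : ∀ g f, ∑ y', ∑ y, X y y' * F (g, y) (f, y') = 0) : X = 0 := by
  ext q p
  calc X q p = ∑ y', ∑ y, X y y' * ∑ f, ∑ g, Ψ (p, f) (q, g) * F (g, y) (f, y') := by
        simp [hΨ p _ q _, ite_and]
    _ = ∑ f, ∑ g, Ψ (p, f) (q, g) * ∑ y', ∑ y, X y y' * F (g, y) (f, y') := by
        simp only [Finset.mul_sum]
        conv_rhs =>
          enter [2, f]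
          rw [Finset.sum_comm]
          enter [2, y']
          rw [Finset.sum_comm]
        conv_rhs => rw [Finset.sum_comm]; enter [2, y']; rw [Finset.sum_comm]
        refine Finset.sum_congr rfl fun y' _ => Finset.sum_congr rfl fun y _ =>
          Finset.sum_congr rfl fun f _ => Finset.sum_congr rfl fun g _ => mul_left_comm _ _ _
    _ = 0 := by simp [h]

theorem IsClosedPair.conjWeight_eq (hΨ : IsClosedPair F Ψ) (hYB : YB F) (hFG : F * G = 1)
    (hGF : G * F = 1) (u w x x' : Fin N) :
    conjWeight (Dmat Ψ) F G u w x x' = if u = w then Dmat Ψ x' x else 0 := by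
  have hbraid : site 3 1 F * emb Fin.castSucc (site 2 0 F) * site 3 1 G =
      emb Fin.castSucc (site 2 0 G) * site 3 1 F * emb Fin.castSucc (site 2 0 F) := by
    have key (X : M2 N K) : emb Fin.castSucc (site 2 0 X) = site 3 0 X :=
      emb_castLE_site (Nat.le_succ 2) (by norm_num) X
    have h0 : site 3 0 G * site 3 0 F = 1 := site_mul_site_eq_one hGF 0
    have h1 : site 3 1 F * site 3 1 G = 1 := site_mul_site_eq_one hFG 1
    rw [key, key]
    calc _ = site 3 0 G * (site 3 0 F * site 3 1 F * site 3 0 F) * site 3 1 G := by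
          rw [mul_assoc (site 3 0 F), ← mul_assoc, h0, one_mul]
      _ = _ := by
          rw [hYB, mul_assoc (site 3 0 G), mul_assoc _ _ (site 3 1 G), h1, mul_one, mul_assoc]
  have htr := congrArg (qtr1 (K := K) (Dmat Ψ)) hbraid
  rw [qtr1_mul_emb, qtr1_emb_mul, qtr1_site_eq_one hΨ.partial_trace, mul_one,
    site_mul_site_eq_one hGF] at htr
  let X : Matrix (Fin N) (Fin N) K := fun y y' =>
    conjWeight (Dmat Ψ) F G u w y y' - if u = w then Dmat Ψ y' y else 0
  have hX : X = 0 := by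
    refine hΨ.eq_zero_of_sum fun g f => ?_
    have h := congrFun₂ htr (Fin.snoc (fun _ : Fin 1 => g) u) (Fin.snoc (fun _ : Fin 1 => f) w)
    have h' := qtr1_conj_snoc (A := K) (D := Dmat Ψ) F G (site 2 0 F) (fun _ : Fin 1 => g)
      (fun _ => f) u w
    replace h := h'.symm.trans h
    have hF (y y' : Fin N) : site 2 0 F (Fin.snoc (fun _ : Fin 1 => g) y)
        (Fin.snoc (fun _ : Fin 1 => f) y') = F (g, y) (f, y') := by
      rw [site_two_zero]
      rfl
    simp only [hF, Algebra.algebraMap_self, RingHom.id_apply, Matrix.one_apply,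
      funext_iff] at h
    simp only [X, sub_mul, Finset.sum_sub_distrib, h]
    split_ifs <;> simp_all [hΨ.partial_trace]
  exact sub_eq_zero.mp (congrFun₂ hX x x')

theorem qtrAll_qtr1 (X : Op N A (n + 1)) : qtrAll D (qtr1 D X) = qtrAll D X := by
  have h (f : (Fin (n + 1) → Fin N) → A) : ∑ a, f a = ∑ a, ∑ x, f (Fin.snoc a x) := by
    rw [← (Fin.snocEquiv fun _ => Fin N).sum_comp, Fintype.sum_prod_type_right]
    rfl
  simp only [qtrAll, qtr1, h, Fin.prod_univ_castSucc, Fin.snoc_castSucc, Fin.snoc_last, map_mul,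
    Finset.mul_sum, mul_assoc]
  refine Finset.sum_congr rfl fun a _ => ?_
  rw [Finset.sum_comm]

theorem qtrs_zero_eq (j : ℕ) (X : Op N A (0 + j)) : qtrs D 0 j X = qtrAll D X • (1 : Op N A 0) := by
  induction j with
  | zero =>
    have h (W : Op N A 0) : W = qtrAll D W • (1 : Op N A 0) := by
      ext a b
      simp [qtrAll, Subsingleton.elim a default, Subsingleton.elim b default]
    exact h X
  | succ j ih => rw [qtrs, ih, ← qtrAll_qtr1 X]

theorem qtr1_conj_castLE {m : ℕ}
    (h : ∀ u w x x', conjWeight D F G u w x x' = if u = w then D x' x else 0)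
    (hm : m = n + 1) (Z : Op N A (n + 1)) :
    qtr1 D (site (m + 1) n (F.map (algebraMap K A)) *
        emb (Fin.castLE (by omega : n + 1 ≤ m + 1)) Z *
        site (m + 1) n (G.map (algebraMap K A))) =
      emb (Fin.castLE (by omega : n ≤ m)) (qtr1 D Z) := by
  subst hm
  exact qtr1_conj h Z

theorem qtrs_conj_chain
    (h : ∀ u w x x', conjWeight D F G u w x x' = if u = w then D x' x else 0)
    (i j : ℕ) (Z : Op N A (i + j)) :
    qtrs D (i + 1) j (chain (i + 1 + j) (F.map (algebraMap K A)) i j *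
        emb (Fin.castLE (by omega : i + j ≤ i + 1 + j)) Z *
        revChain (i + 1 + j) (G.map (algebraMap K A)) i j) =
      emb Fin.castSucc (qtrs D i j Z) := by
  induction j with
  | zero =>
    change qtrs D (i + 1) 0 (1 * emb Fin.castSucc Z * 1) = _
    rw [one_mul, mul_one]
    rfl
  | succ j ih =>
    rw [qtrs, qtrs, ← ih]
    congr 1
    rw [chain, revChain,
      ← emb_castLE_chain (n := i + 1 + j) (m := i + 1 + (j + 1)) (by omega) (by omega),
      ← emb_castLE_revChain (n := i + 1 + j) (m := i + 1 + (j + 1)) (by omega) (by omega),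
      mul_assoc (emb _ _), mul_assoc (emb _ _), ← mul_assoc _ (site _ _ _), ← mul_assoc]
    exact (qtr1_mul_emb _ _).trans (congrArg (· * _) ((qtr1_emb_mul _ _).trans
      (congrArg (_ * ·) (qtr1_conj_castLE h (show i + 1 + j = i + j + 1 by omega) Z))))

end Trace

/-- Lemma b, (16).  For compatible R-matrices `R̂, F̂` with `F̂`
closed and an arbitrary matrix `M` over `A`:  for every polynomial `Y^{(k)}` in
`R̂₁,…,R̂_{k−1}` and every `i ≥ 1`,
`Tr_F(i,…,i+k−1)(Y^{(i,k)} M_{\overline{i}} ⋯ M_{\overline{i+k−1}}) = I_{1,…,i−1} ⬝ α(Y^{(k)})`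
where `α(Y^{(k)}) = Tr_F(1,…,k)(Y^{(k)} M_{\overline{1}} ⋯ M_{\overline{k}})`.
Here `k = k0 + 1 ≥ 1`, the paper's `i` is `i0 + 1 ≥ 1`, `Y` is a noncommutative
polynomial in `k0` variables and `evalY R p Y` is its evaluation at
`R̂_{p+1},…,R̂_{p+k0}`; the total space is `V^{⊗(i0 + (k0+1))}` and the quantum
trace is taken over the last `k0+1` factors, leaving an operator on `V^{⊗i0}`. -/
theorem qtrace_of_shifted_poly {K : Type} [Field K] {A : Type} [Ring A] [Algebra K A]
    {N : ℕ} (R F Ψ : M2 N K) (hR : IsUnit R) (hF : IsUnit F)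
    (h : Compatible R F) (hΨ : IsClosedPair F Ψ)
    (M : Matrix (Fin N) (Fin N) A) :
    ∀ (k0 : ℕ) (Y : FreeAlgebra K (Fin k0)) (i0 : ℕ),
      qtrs (Dmat Ψ) i0 (k0 + 1)
          (evalY (R.map (algebraMap K A)) i0 Y *
            MbarSeg (i0 + (k0 + 1)) (F.map (algebraMap K A))
              ((F⁻¹).map (algebraMap K A)) M i0 (k0 + 1)) =
        qtrAll (Dmat Ψ)
            (evalY (R.map (algebraMap K A)) 0 Y *
              MbarSeg (k0 + 1) (F.map (algebraMap K A))
                ((F⁻¹).map (algebraMap K A)) M 0 (k0 + 1)) •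
          (1 : Op N A i0) := by
  intro k0 Y i0
  have hdet : IsUnit F.det := (Matrix.isUnit_iff_isUnit_det F).mp hF
  have hcentral (X : M2 N K) (a b : Fin N × Fin N) (x : A) :
      Commute (X.map (algebraMap K A) a b) x := Algebra.commutes _ _
  have hFG : F.map (algebraMap K A) * (F⁻¹).map (algebraMap K A) = 1 := by
    rw [← Matrix.map_mul, Matrix.mul_nonsing_inv _ hdet, Matrix.map_one _ (map_zero _) (map_one _)]
  have hGF : (F⁻¹).map (algebraMap K A) * F.map (algebraMap K A) = 1 := by
    rw [← Matrix.map_mul, Matrix.nonsing_inv_mul _ hdet, Matrix.map_one _ (map_zero _) (map_one _)]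
  have hYB : YB (F.map (algebraMap K A)) := by
    simp only [YB, site_map, ← Matrix.map_mul]
    rw [h.2.1]
  have hRF : site 3 0 (F.map (algebraMap K A)) * site 3 1 (F.map (algebraMap K A)) *
      site 3 0 (R.map (algebraMap K A)) = site 3 1 (R.map (algebraMap K A)) *
      site 3 0 (F.map (algebraMap K A)) * site 3 1 (F.map (algebraMap K A)) := by
    simp only [site_map, ← Matrix.map_mul]
    rw [h.2.2.2]
  have hD := hΨ.conjWeight_eq h.2.1 (Matrix.mul_nonsing_inv _ hdet) (Matrix.nonsing_inv_mul _ hdet)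
  induction i0 with
  | zero =>
    have hzero (n : ℕ) (hn : n = k0 + 1) :
        qtrAll (Dmat Ψ) (evalY (R.map (algebraMap K A)) 0 Y *
          MbarSeg n (F.map (algebraMap K A)) ((F⁻¹).map (algebraMap K A)) M 0 (k0 + 1)) =
        qtrAll (Dmat Ψ) (evalY (R.map (algebraMap K A)) 0 Y *
          MbarSeg (k0 + 1) (F.map (algebraMap K A)) ((F⁻¹).map (algebraMap K A)) M 0
            (k0 + 1)) := by
      subst hn
      rfl
    rw [qtrs_zero_eq, hzero _ (zero_add _)]
  | succ i ih =>
    have hY := chain_semiconj_evalY (m := i + 1 + (k0 + 1)) (hcentral F) hRF (i := i) (by omega) Y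
    have hM := chain_semiconj_MbarSeg (M := M) (m := i + 1 + (k0 + 1)) (hcentral F)
      (hcentral F⁻¹) hFG hGF hYB (i := i) (le_refl (k0 + 1)) (by omega)
    have hle : i + (k0 + 1) ≤ i + 1 + (k0 + 1) := by omega
    have hpad := emb_castLE_mul hle (evalY (R.map (algebraMap K A)) i Y)
      (MbarSeg (i + (k0 + 1)) (F.map (algebraMap K A)) ((F⁻¹).map (algebraMap K A)) M i (k0 + 1))
    rw [emb_castLE_evalY hle (by omega), emb_castLE_MbarSeg hle le_rfl] at hpad
    rw [← mul_one (evalY _ _ _ * _), ← chain_mul_revChain hFG i (k0 + 1), ← mul_assoc,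
      ← (hY.mul_right hM).eq, ← hpad, qtrs_conj_chain hD, ih, emb_smul, emb_one]

end CHN
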